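/- arXiv:2504.19304 — 3 statements merged into one kernel-verified Lean document; each statement's English description precedes it below -/
import Mathlib

section
/- Let k be a positive integer, F a field, and C ⊆ F^n a linear subspace such that the k-th Schur power C^⟨k⟩ has trivial stabiliser (i.e., dim St(C^⟨k⟩) = 1). Then dim C^⟨k⟩ ≥ k·dim C − k + 1. -/
open Submodule

/-- The (Schur / coordinatewise) product of two subspaces of `Fin n → K`. -/
def schurMul {K : Type*} [CommRing K] {n : ℕ} (C D : Submodule K (Fin n → K)) :
    Submodule K (Fin n → K) :=
  Submodule.span K {x | ∃ c ∈ C, ∃ d ∈ D, x = c * d}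

/-- `schurPow C k` is the `(k+1)`-st Schur power `C^⟨k+1⟩`; so `schurPow C 0 = C^⟨1⟩ = C`. -/
def schurPow {K : Type*} [CommRing K] {n : ℕ} (C : Submodule K (Fin n → K)) :
    ℕ → Submodule K (Fin n → K)
  | 0 => C
  | k + 1 => schurMul (schurPow C k) C

/-- The stabiliser `St(E) = {x : x * E ⊆ E}` of a subspace, itself a subspace. -/
def stab {K : Type*} [CommRing K] {n : ℕ} (E : Submodule K (Fin n → K)) :
    Submodule K (Fin n → K) where
  carrier := {x | ∀ e ∈ E, x * e ∈ E}
  add_mem' := fun {a b} ha hb e he => by simpa [add_mul] using E.add_mem (ha e he) (hb e he)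
  zero_mem' := fun e he => by simp
  smul_mem' := fun c {x} hx e he => by simpa [smul_mul_assoc] using E.smul_mem c (hx e he)

/-- Support of a subspace of `Fin n → K`. -/
def suppS {K : Type*} [CommRing K] {n : ℕ} (C : Submodule K (Fin n → K)) : Set (Fin n) :=
  {i | ∃ v ∈ C, v i ≠ 0}

/-- Characteristic vector of a finite set. -/
def charVec (R : Type*) [Zero R] [One R] {n : ℕ} (A : Finset (Fin n)) : Fin n → R :=
  fun i => if i ∈ A then 1 else 0

/-- `𝓕` is `k`-wise `ℓ`-divisible: every intersection of `k` (not necessarily distinct)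
members of `𝓕` has cardinality divisible by `ℓ`. -/
def kWiseDiv (n k ℓ : ℕ) (𝓕 : Finset (Finset (Fin n))) : Prop :=
  ∀ A : Fin k → Finset (Fin n), (∀ i, A i ∈ 𝓕) → ℓ ∣ (Finset.univ.inf A).card

/-- Support of a set family. -/
def famSupp {n : ℕ} (ℱ : Set (Finset (Fin n))) : Set (Fin n) :=
  ⋃ B ∈ ℱ, (B : Set (Fin n))

/-- `A` is an atom of the family `ℱ`: a nonempty subset of the support such that every
member of `ℱ` contains `A` or is disjoint from it, maximal with this property. -/
def IsAtomOf {n : ℕ} (ℱ : Set (Finset (Fin n))) (A : Finset (Fin n)) : Prop :=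
  A.Nonempty ∧ (A : Set (Fin n)) ⊆ famSupp ℱ ∧ (∀ B ∈ ℱ, A ⊆ B ∨ Disjoint A B) ∧
    ∀ A' : Finset (Fin n), A ⊆ A' → (A' : Set (Fin n)) ⊆ famSupp ℱ →
      (∀ B ∈ ℱ, A' ⊆ B ∨ Disjoint A' B) → A' = A

/-- The family `ℱ^r` of all `r`-fold intersections of members of `ℱ`. -/
def interFam {n : ℕ} (ℱ : Set (Finset (Fin n))) (r : ℕ) : Set (Finset (Fin n)) :=
  {S | ∃ f : Fin r → Finset (Fin n), (∀ i, f i ∈ ℱ) ∧ S = Finset.univ.inf f}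

/-- The linear map sending `v` to its restriction (indicator) on a coordinate set `S`. -/
noncomputable def indicatorMapL {K : Type*} [CommRing K] {n : ℕ} (S : Set (Fin n)) :
    (Fin n → K) →ₗ[K] (Fin n → K) where
  toFun v := S.indicator v
  map_add' a b := by
    funext i; by_cases h : i ∈ S <;> simp [Set.indicator_apply, h]
  map_smul' c a := by
    funext i; by_cases h : i ∈ S <;> simp [Set.indicator_apply, h]

/-- Restriction (projection) of a subspace `V` to the coordinates in `S`. -/
noncomputable def restrTo {K : Type*} [CommRing K] {n : ℕ} (S : Set (Fin n))
    (V : Submodule K (Fin n → K)) : Submodule K (Fin n → K) :=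
  V.map (indicatorMapL S)

theorem schurMul_eq_mul {K : Type*} [CommRing K] {n : ℕ} (C D : Submodule K (Fin n → K)) :
    schurMul C D = C * D := by
  rw [Submodule.mul_eq_span_mul_set, schurMul]
  congr 1
  ext x
  simp only [Set.mem_setOf_eq, Set.mem_mul, SetLike.mem_coe]
  constructor
  · rintro ⟨c, hc, d, hd, rfl⟩; exact ⟨c, hc, d, hd, rfl⟩
  · rintro ⟨c, hc, d, hd, rfl⟩; exact ⟨c, hc, d, hd, rfl⟩

theorem schurPow_eq_pow {K : Type*} [CommRing K] {n : ℕ} (C : Submodule K (Fin n → K)) (k : ℕ) :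
    schurPow C k = C ^ (k + 1) := by
  induction k with
  | zero => simp [schurPow]
  | succ k ih => rw [schurPow, schurMul_eq_mul, ih, pow_succ C (k + 1)]

/-- A nonconstant stabilising vector produces a nontrivial stabilising idempotent. -/
theorem exists_charVec_stab {L : Type*} [Field L] {n : ℕ} (B : Submodule L (Fin n → L))
    (x : Fin n → L) (hx : x ∈ stab B) (i j : Fin n) (hij : x i ≠ x j) :
    ∃ S : Finset (Fin n), i ∈ S ∧ j ∉ S ∧ charVec L S ∈ stab B := by
  classical
  have hpow : ∀ m : ℕ, x ^ m ∈ stab B := by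
    intro m
    induction m with
    | zero => intro e he; simpa using he
    | succ m ih =>
      intro e he
      rw [pow_succ, mul_assoc]
      exact ih _ (hx e he)
  have hpoly : ∀ p : Polynomial L, Polynomial.aeval x p ∈ stab B := by
    intro p
    rw [Polynomial.aeval_eq_sum_range]
    exact Submodule.sum_mem _ fun m _ => Submodule.smul_mem _ _ (hpow m)
  refine ⟨Finset.univ.filter (fun l => x l = x i), by simp, by simp [Ne.symm hij], ?_⟩
  let s : Finset L := Finset.univ.image x
  let p : Polynomial L := Lagrange.interpolate s id (fun c => if c = x i then 1 else 0)
  convert hpoly p using 1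
  funext l
  have h1 : (Polynomial.aeval x p) l = Polynomial.eval (x l) p := by
    have := Polynomial.aeval_algHom_apply (Pi.evalAlgHom L (fun _ : Fin n => L) l) x p
    simp only [Pi.evalAlgHom_apply] at this
    rw [← this, Polynomial.coe_aeval_eq_eval]
  rw [h1]
  have h2 := Lagrange.eval_interpolate_at_node (s := s) (v := id) (i := x l)
    (fun c => if c = x i then (1 : L) else 0) (Function.injective_id.injOn) (by simp [s])
  simp only [id] at h2
  simp only [p]
  rw [h2]
  simp [charVec]

/-- The local Kneser lemma, by the Dyson transform. -/
theorem local_kneser {L : Type*} [Field L] {n : ℕ} (m : ℕ) : ∀ (A B : Submodule L (Fin n → L)),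
    Module.finrank L A = m → 1 ∈ A →
    (Module.finrank L A + Module.finrank L B ≤ Module.finrank L ↥(A * B) + 1) ∨
    ∃ S : Finset (Fin n), (∃ i ∈ S, ∃ j, j ∉ S) ∧ ∀ b ∈ B, charVec L S * b ∈ A * B := by
  induction m using Nat.strong_induction_on with
  | _ m ih =>
  intro A B hm h1
  have hBAB : B ≤ A * B := fun b hb => by simpa using Submodule.mul_mem_mul h1 hb
  by_cases hall : ∀ e ∈ B, ∀ a ∈ A, a * e ∈ B
  · by_cases hconst : ∀ a ∈ A, ∀ i j, a i = a j
    · left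
      have hA : Module.finrank L A ≤ 1 := by
        have : A ≤ L ∙ (1 : Fin n → L) := by
          intro a ha
          rcases isEmpty_or_nonempty (Fin n) with hn | ⟨⟨i⟩⟩
          · rw [Subsingleton.elim a 0]; exact zero_mem _
          · refine Submodule.mem_span_singleton.2 ⟨a i, ?_⟩
            funext j
            simp [hconst a ha i j]
        exact (Submodule.finrank_mono this).trans ((finrank_span_le_card _).trans (by simp))
      have := Submodule.finrank_mono hBAB
      omega
    · right
      push Not at hconst
      obtain ⟨a, ha, i, j, hij⟩ := hconst
      obtain ⟨S, hi, hj, hS⟩ := exists_charVec_stab B a (fun e he => hall e he a ha) i j hij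
      exact ⟨S, ⟨i, hi, j, hj⟩, fun b hb => hBAB (hS b hb)⟩
  · push Not at hall
    obtain ⟨e, he, a, ha, hae⟩ := hall
    let f : (Fin n → L) →ₗ[L] (Fin n → L) := LinearMap.mulRight L e
    let A' := A ⊓ B.comap f
    let B' := B ⊔ A.map f
    have hlt : A' < A := by
      refine lt_of_le_of_ne inf_le_left fun h => hae ?_
      have : a ∈ A' := h ▸ ha
      exact this.2
    have hsub : A' * B' ≤ A * B := by
      rw [Submodule.mul_le]
      intro x hx y hy
      obtain ⟨b, hb, z, hz, rfl⟩ := Submodule.mem_sup.1 hy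
      obtain ⟨c, hc, rfl⟩ := hz
      rw [mul_add]
      refine add_mem (Submodule.mul_mem_mul hx.1 hb) ?_
      have : x * f c = c * f x := by simp [f]; ring
      rw [this]
      exact Submodule.mul_mem_mul hc hx.2
    have hdim : Module.finrank L A' + Module.finrank L B' =
        Module.finrank L A + Module.finrank L B := by
      have e1 := Submodule.finrank_sup_add_finrank_inf_eq B (A.map f)
      have e2 : B ⊓ A.map f = A'.map f := by
        ext y
        constructor
        · rintro ⟨hy, c, hc, rfl⟩
          exact ⟨c, ⟨hc, hy⟩, rfl⟩
        · rintro ⟨c, hc, rfl⟩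
          exact ⟨hc.2, c, hc.1, rfl⟩
      rw [e2] at e1
      have e3 := LinearMap.finrank_range_add_finrank_ker (f.domRestrict A)
      have e4 := LinearMap.finrank_range_add_finrank_ker (f.domRestrict A')
      rw [LinearMap.range_domRestrict] at e3 e4
      have k1 : Module.finrank L (LinearMap.ker (f.domRestrict A)) =
          Module.finrank L ↥(A ⊓ LinearMap.ker f) := by
        rw [LinearMap.ker_domRestrict, ← Submodule.finrank_map_subtype_eq,
          Submodule.map_comap_subtype]
      have k2 : Module.finrank L (LinearMap.ker (f.domRestrict A')) =
          Module.finrank L ↥(A' ⊓ LinearMap.ker f) := by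
        rw [LinearMap.ker_domRestrict, ← Submodule.finrank_map_subtype_eq,
          Submodule.map_comap_subtype]
      have k3 : A' ⊓ LinearMap.ker f = A ⊓ LinearMap.ker f := by
        ext y
        constructor
        · rintro ⟨h, h'⟩; exact ⟨h.1, h'⟩
        · rintro ⟨h, h'⟩
          refine ⟨⟨h, ?_⟩, h'⟩
          have h2 : f y = 0 := h'
          change f y ∈ B
          rw [h2]; exact zero_mem _
      rw [k3] at k2
      change Module.finrank L A' + Module.finrank L ↥(B ⊔ A.map f) = _
      omega
    have h1' : (1 : Fin n → L) ∈ A' := ⟨h1, by change f 1 ∈ B; simpa [f] using he⟩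
    rcases ih _ (hm ▸ Submodule.finrank_lt_finrank_of_lt hlt) A' B' rfl h1' with h | ⟨S, hS, h⟩
    · left
      have := Submodule.finrank_mono hsub
      omega
    · right
      exact ⟨S, hS, fun b hb => hsub (h b (Submodule.mem_sup_left hb))⟩

/-- Kneser's theorem with trivial stabiliser over an infinite field. -/
theorem kneser_infinite {L : Type*} [Field L] [Infinite L] {n : ℕ}
    (A B : Submodule L (Fin n → L)) (hA : ∀ i, ∃ v ∈ A, v i ≠ 0)
    (hst : ∀ x ∈ stab (A * B), ∀ i j, x i = x j) :
    Module.finrank L A + Module.finrank L B ≤ Module.finrank L ↥(A * B) + 1 := by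
  classical
  by_contra hcon
  have key : ∀ a ∈ A, (∀ i, a i ≠ 0) →
      ∃ S : Finset (Fin n), (∃ i ∈ S, ∃ j, j ∉ S) ∧ ∀ b ∈ B, charVec L S * (a * b) ∈ A * B := by
    intro a ha hne
    have hinv : a⁻¹ * a = 1 := by funext i; simp [hne i]
    have hinv' : a * a⁻¹ = 1 := by rw [mul_comm]; exact hinv
    let g : (Fin n → L) →ₗ[L] (Fin n → L) := LinearMap.mulLeft L a⁻¹
    have hg : Function.Injective g := by
      intro x y hxy
      have h : a⁻¹ * x = a⁻¹ * y := hxy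
      have h2 := congrArg (a * ·) h
      simpa [← mul_assoc, hinv'] using h2
    have hmul : A.map g * B = (A * B).map g := by
      apply le_antisymm
      · rw [Submodule.mul_le]
        rintro _ ⟨x, hx, rfl⟩ b hb
        exact ⟨x * b, Submodule.mul_mem_mul hx hb, by simp [g, mul_assoc]⟩
      · rw [Submodule.map_le_iff_le_comap, Submodule.mul_le]
        intro x hx b hb
        have : g (x * b) = g x * b := by simp [g, mul_assoc]
        rw [Submodule.mem_comap, this]
        exact Submodule.mul_mem_mul ⟨x, hx, rfl⟩ hb
    have hfr : ∀ E : Submodule L (Fin n → L), Module.finrank L (E.map g) = Module.finrank L E :=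
      fun E => (Submodule.equivMapOfInjective g hg E).finrank_eq.symm
    rcases local_kneser _ (A.map g) B rfl ⟨a, ha, by simpa [g] using hinv⟩ with h | ⟨S, hS, h⟩
    · rw [hmul, hfr, hfr] at h
      exact absurd h hcon
    · refine ⟨S, hS, fun b hb => ?_⟩
      have h2 := h b hb
      rw [hmul] at h2
      obtain ⟨y, hy, hy2⟩ := h2
      have h3 : a⁻¹ * y = charVec L S * b := hy2
      have : charVec L S * (a * b) = y := by
        calc charVec L S * (a * b) = a * (charVec L S * b) := by ring
          _ = a * (a⁻¹ * y) := by rw [h3]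
          _ = y := by rw [← mul_assoc, hinv', one_mul]
      rw [this]; exact hy
  let T := {S : Finset (Fin n) // ∃ i ∈ S, ∃ j, j ∉ S}
  let P : Finset (Fin n) → Submodule L A := fun S =>
    { carrier := {a | ∀ b ∈ B, charVec L S * ((a : Fin n → L) * b) ∈ A * B}
      add_mem' := fun {x y} hx hy b hb => by
        have := add_mem (hx b hb) (hy b hb)
        simpa [add_mul, mul_add] using this
      zero_mem' := fun b hb => by simp
      smul_mem' := fun c {x} hx b hb => by
        have := Submodule.smul_mem _ c (hx b hb)
        simpa [smul_mul_assoc, mul_smul_comm] using this }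
  let Q : T ⊕ Fin n → Submodule L A := Sum.elim (fun S => P S.1)
    (fun i => LinearMap.ker ((LinearMap.proj i : (Fin n → L) →ₗ[L] L).domRestrict A))
  have hcov : ⋃ t, (Q t : Set A) = Set.univ := by
    rw [Set.eq_univ_iff_forall]
    intro a
    rw [Set.mem_iUnion]
    by_cases hne : ∀ i, (a : Fin n → L) i ≠ 0
    · obtain ⟨S, hS, h⟩ := key a a.2 hne
      exact ⟨Sum.inl ⟨S, hS⟩, h⟩
    · push Not at hne
      obtain ⟨i, hi⟩ := hne
      exact ⟨Sum.inr i, by simpa [Q] using hi⟩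
  obtain ⟨t, ht⟩ := Subspace.exists_eq_top_of_iUnion_eq_univ hcov
  rcases t with ⟨S, i, hi, j, hj⟩ | i
  · have hs : charVec L S ∈ stab (A * B) := by
      intro e he
      refine Submodule.mul_induction_on he ?_ ?_
      · intro a ha b hb
        have : (⟨a, ha⟩ : A) ∈ P S := by
          have h : P S = ⊤ := ht
          rw [h]; trivial
        exact this b hb
      · intro x y hx hy
        rw [mul_add]; exact add_mem hx hy
    have := hst _ hs i j
    simp [charVec, hi, hj] at this
  · obtain ⟨v, hv, hvi⟩ := hA i
    have : (⟨v, hv⟩ : A) ∈ Q (Sum.inr i) := by rw [ht]; trivial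
    exact hvi (by simpa [Q] using this)

/-- The extension of scalars of a code. -/
def extCode {K : Type*} (L : Type*) [Field K] [Field L] [Algebra K L] {n : ℕ}
    (E : Submodule K (Fin n → K)) : Submodule L (Fin n → L) :=
  Submodule.span L ((fun v : Fin n → K => algebraMap K L ∘ v) '' E)

theorem extCode_mul {K L : Type*} [Field K] [Field L] [Algebra K L] {n : ℕ}
    (A B : Submodule K (Fin n → K)) : extCode L (A * B) = extCode L A * extCode L B := by
  have hm : ∀ v w : Fin n → K, (algebraMap K L ∘ (v * w)) =
      (algebraMap K L ∘ v) * (algebraMap K L ∘ w) := by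
    intro v w; funext i; simp
  apply le_antisymm
  · rw [extCode, Submodule.span_le]
    rintro _ ⟨x, hx, rfl⟩
    refine Submodule.mul_induction_on hx ?_ ?_
    · intro a ha b hb
      simp only [hm]
      exact Submodule.mul_mem_mul (Submodule.subset_span ⟨a, ha, rfl⟩)
        (Submodule.subset_span ⟨b, hb, rfl⟩)
    · intro x y hx hy
      have := add_mem hx hy
      have h2 : algebraMap K L ∘ (x + y) = algebraMap K L ∘ x + algebraMap K L ∘ y := by
        funext i; simp
      simp only [h2]
      exact this
  · rw [extCode, extCode, Submodule.span_mul_span, Submodule.span_le]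
    rintro _ ⟨_, ⟨a, ha, rfl⟩, _, ⟨b, hb, rfl⟩, rfl⟩
    exact Submodule.subset_span ⟨a * b, Submodule.mul_mem_mul ha hb, hm a b⟩

theorem finrank_extCode {K L : Type*} [Field K] [Field L] [Algebra K L] {n : ℕ}
    (E : Submodule K (Fin n → K)) : Module.finrank L (extCode L E) = Module.finrank K E := by
  let b := Module.finBasis K E
  let w : Fin (Module.finrank K E) → Fin n → L := fun t => algebraMap K L ∘ (b t : Fin n → K)
  have hw : LinearIndependent L w := by
    have h0 : LinearIndependent K (fun t => (b t : Fin n → K)) :=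
      b.linearIndependent.map' E.subtype (Submodule.ker_subtype E)
    exact linearIndependent_algebraMap_comp_iff.2 h0
  have hspan : extCode L E = Submodule.span L (Set.range w) := by
    apply le_antisymm
    · rw [extCode, Submodule.span_le]
      rintro _ ⟨x, hx, rfl⟩
      have hr := b.sum_repr ⟨x, hx⟩
      have hr2 : x = ∑ t, b.repr ⟨x, hx⟩ t • (b t : Fin n → K) := by
        have := congrArg E.subtype hr
        rw [map_sum] at this
        simp only [map_smul, Submodule.subtype_apply] at this
        exact this.symm
      have : algebraMap K L ∘ x = ∑ t, algebraMap K L (b.repr ⟨x, hx⟩ t) • w t := by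
        funext i
        have := congrArg (algebraMap K L) (congrFun hr2 i)
        simpa [w, Finset.sum_apply, Algebra.smul_def] using this
      simp only [this]
      exact Submodule.sum_mem _ fun t _ => Submodule.smul_mem _ _ (Submodule.subset_span ⟨t, rfl⟩)
    · rw [Submodule.span_le]
      rintro _ ⟨t, rfl⟩
      exact Submodule.subset_span ⟨b t, (b t).2, rfl⟩
  rw [hspan, finrank_span_eq_card hw, Fintype.card_fin]

theorem stab_extCode {K L : Type*} [Field K] [Field L] [Algebra K L] {n : ℕ}
    (E : Submodule K (Fin n → K)) (hst : ∀ x ∈ stab E, ∀ i j, x i = x j) :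
    ∀ x ∈ stab (extCode L E), ∀ i j, x i = x j := by
  intro x hx i j
  rw [← sub_eq_zero]
  rw [← Module.forall_dual_apply_eq_zero_iff K]
  intro φ
  have hφ : ∀ y ∈ extCode L E, (fun l => φ (y l)) ∈ E := by
    intro y hy
    refine Submodule.span_induction (p := fun y _ => ∀ c : L, (fun l => φ (c * y l)) ∈ E)
      ?_ ?_ ?_ ?_ hy 1 |> fun h => by simpa using h
    · rintro _ ⟨v, hv, rfl⟩ c
      have : (fun l => φ (c * (algebraMap K L ∘ v) l)) = φ c • v := by
        funext l
        have : c * algebraMap K L (v l) = v l • c := by rw [Algebra.smul_def, mul_comm]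
        simp [this, mul_comm]
      rw [this]; exact E.smul_mem _ hv
    · intro c
      simp only [Pi.zero_apply, mul_zero, map_zero]
      exact zero_mem E
    · intro y z _ _ h1 h2 c
      have := add_mem (h1 c) (h2 c)
      simp only [Pi.add_apply, mul_add, map_add]
      exact this
    · intro a y _ h c
      have := h (c * a)
      simpa [mul_assoc] using this
  have hs : (fun l => φ (x l)) ∈ stab E := by
    intro e he
    have h1 := hφ _ (hx _ (Submodule.subset_span ⟨e, he, rfl⟩))
    convert h1 using 1
    funext l
    have : x l * algebraMap K L (e l) = e l • x l := by rw [Algebra.smul_def, mul_comm]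
    simp [this, mul_comm]
  have := hst _ hs i j
  rw [map_sub, this, sub_self]

theorem kneser_trivial {K : Type*} [Field K] {n : ℕ}
    (A B : Submodule K (Fin n → K)) (hA : ∀ i, ∃ v ∈ A, v i ≠ 0)
    (hst : ∀ x ∈ stab (A * B), ∀ i j, x i = x j) :
    Module.finrank K A + Module.finrank K B ≤ Module.finrank K ↥(A * B) + 1 := by
  have h := kneser_infinite (L := AlgebraicClosure K) (extCode _ A) (extCode _ B)
    (fun i => by
      obtain ⟨v, hv, hvi⟩ := hA i
      exact ⟨_, Submodule.subset_span ⟨v, hv, rfl⟩, by simpa using hvi⟩)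
    (by rw [← extCode_mul]; exact stab_extCode _ hst)
  rwa [← extCode_mul, finrank_extCode, finrank_extCode, finrank_extCode] at h

theorem pow_bound {K : Type*} [Field K] {n : ℕ} (C : Submodule K (Fin n → K))
    (hC : ∀ i, ∃ v ∈ C, v i ≠ 0) (k : ℕ)
    (hst : ∀ x ∈ stab (C ^ (k + 1)), ∀ i j, x i = x j) :
    (k + 1) * Module.finrank K C + 1 ≤ Module.finrank K ↥(C ^ (k + 1)) + (k + 1) := by
  induction k with
  | zero =>
    have h : C ^ (0 + 1) = C := by rw [zero_add, pow_one]
    rw [h]; omega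
  | succ k ih =>
    rw [pow_succ' C (k + 1)] at hst ⊢
    have h1 := kneser_trivial C (C ^ (k + 1)) hC hst
    have h2 := ih (fun x hx => hst x (by
      intro e he
      refine Submodule.mul_induction_on he ?_ ?_
      · intro a ha b hb
        rw [mul_left_comm]
        exact Submodule.mul_mem_mul ha (hx b hb)
      · intro y z hy hz
        rw [mul_add]; exact add_mem hy hz))
    have : (k + 1 + 1) * Module.finrank K C = (k + 1) * Module.finrank K C + Module.finrank K C := by
      ring
    omega

/-- if `C^⟨k⟩` has trivial stabiliser then
`dim C^⟨k⟩ ≥ k·dim C − k + 1`.  (Recall `schurPow C (k-1) = C^⟨k⟩`.) -/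
theorem statement5 (K : Type*) [Field K] (n k : ℕ) (hk : 0 < k)
    (C : Submodule K (Fin n → K))
    (hst : Module.finrank K ↥(stab (schurPow C (k - 1))) = 1) :
    k * Module.finrank K ↥C + 1 ≤ Module.finrank K ↥(schurPow C (k - 1)) + k := by
  obtain ⟨k, rfl⟩ : ∃ m, k = m + 1 := ⟨k - 1, by omega⟩
  rw [Nat.add_sub_cancel] at hst ⊢
  rw [schurPow_eq_pow] at hst ⊢
  have hconst : ∀ x ∈ stab (C ^ (k + 1)), ∀ i j, x i = x j := by
    intro x hx i j
    have h1 : (1 : Fin n → K) ∈ stab (C ^ (k + 1)) := fun e he => by simpa using he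
    have hne : (⟨1, h1⟩ : stab (C ^ (k + 1))) ≠ 0 := by
      intro h
      have := congrFun (congrArg Subtype.val h) i
      simp at this
    obtain ⟨c, hc⟩ := (finrank_eq_one_iff_of_nonzero' _ hne).1 hst ⟨x, hx⟩
    have hc2 : c • (1 : Fin n → K) = x := congrArg Subtype.val hc
    rw [← hc2]; simp
  by_cases hC : ∀ i, ∃ v ∈ C, v i ≠ 0
  · exact pow_bound C hC k hconst
  · push Not at hC
    obtain ⟨i, hi⟩ := hC
    have hs : Pi.single i (1 : K) ∈ stab (C ^ (k + 1)) := by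
      intro e he
      rw [pow_succ] at he
      have : Pi.single i (1 : K) * e = 0 := by
        refine Submodule.mul_induction_on he ?_ ?_
        · intro a _ b hb
          funext j
          by_cases hj : j = i
          · subst hj; simp [hi b hb]
          · simp [hj]
        · intro y z hy hz
          rw [mul_add, hy, hz, add_zero]
      rw [this]; exact zero_mem _
    have hall : ∀ j, j = i := by
      intro j
      by_contra hj
      have := hconst _ hs i j
      simp [hj] at this
    have hbot : C = ⊥ := by
      rw [Submodule.eq_bot_iff]
      intro v hv
      funext j
      rw [hall j]; exact hi v hv
    have h0 : Module.finrank K C = 0 := by rw [hbot]; simp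
    rw [h0]; omega
end

section
/- Let t be a positive integer and F ⊆ {0,1}^n contain at least two non-zero sets. Let V be the F_p-span of F and suppose V^⟨t+1⟩ has trivial stabiliser. Then dim V > t + 1 and dim V^⟨t+1⟩ > (t+1)². -/
open Submodule

section helpers

variable {K : Type*} [Field K] {n : ℕ}

/-- A subspace over an infinite field covered by finitely many subspaces lies in one of them. -/
theorem cover_lemma [Infinite K] {E : Type*} [AddCommGroup E] [Module K E]
    {ι : Type*} [Finite ι] (A : Submodule K E) (P : ι → Submodule K E)
    (h : ∀ a ∈ A, ∃ i, a ∈ P i) : ∃ i, A ≤ P i := by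
  obtain ⟨i, hi⟩ := Subspace.exists_eq_top_of_iUnion_eq_univ
    (p := fun i => (P i).comap A.subtype) (by
      ext a
      simpa using h a.1 a.2)
  refine ⟨i, fun a ha => ?_⟩
  have : (⟨a, ha⟩ : A) ∈ (P i).comap A.subtype := by rw [hi]; trivial
  simpa using this

/-- The hyperplane `x i = 0`. -/
def hyp (K : Type*) [Field K] {n : ℕ} (i : Fin n) : Submodule K (Fin n → K) :=
  LinearMap.ker (LinearMap.proj (R := K) (φ := fun _ : Fin n => K) i)

theorem mem_hyp (i : Fin n) (x : Fin n → K) : x ∈ hyp K i ↔ x i = 0 := by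
  simp [hyp]

/-- If every invertible element of `A` (full support) lies in one of the `P i`, then `A` lies
in one of the `P i`. -/
theorem cover_unit [Infinite K] {ι : Type*} [Finite ι] (A : Submodule K (Fin n → K))
    (hA : ∀ i, ∃ v ∈ A, v i ≠ 0) (P : ι → Submodule K (Fin n → K))
    (h : ∀ a ∈ A, (∀ i, a i ≠ 0) → ∃ i, a ∈ P i) : ∃ i, A ≤ P i := by
  obtain ⟨i, hi⟩ := cover_lemma A (Sum.elim P (fun i : Fin n => hyp K i)) (by
    intro a ha
    by_cases h0 : ∀ i, a i ≠ 0
    · obtain ⟨i, hi⟩ := h a ha h0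
      exact ⟨Sum.inl i, hi⟩
    · push Not at h0
      obtain ⟨i, hi⟩ := h0
      exact ⟨Sum.inr i, (mem_hyp i a).2 hi⟩)
  rcases i with i | i
  · exact ⟨i, hi⟩
  · obtain ⟨v, hv, hv0⟩ := hA i
    exact absurd ((mem_hyp i v).1 (hi hv)) hv0

theorem mem_stab {R : Type*} [CommRing R] (E : Submodule R (Fin n → R)) (x : Fin n → R) :
    x ∈ stab E ↔ ∀ e ∈ E, x * e ∈ E := Iff.rfl

/-- A nonconstant element of the stabiliser yields a nontrivial idempotent. -/
theorem stab_exists_idem (B : Submodule K (Fin n → K)) (x : Fin n → K) (hx : x ∈ stab B)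
    (i j : Fin n) (hij : x i ≠ x j) :
    ∃ S : Finset (Fin n), i ∈ S ∧ j ∉ S ∧ charVec K S ∈ stab B := by
  classical
  refine ⟨Finset.univ.filter (fun k => x k = x i), by simp, by simpa using hij.symm, ?_⟩
  have key : charVec K (Finset.univ.filter (fun k => x k = x i)) =
      ∏ c ∈ (Finset.univ.image x).erase (x i), ((x i - c)⁻¹ • (x - c • (1 : Fin n → K))) := by
    funext k
    simp only [charVec, Finset.mem_filter, Finset.mem_univ, true_and, Finset.prod_apply,
      Pi.smul_apply, Pi.sub_apply, Pi.one_apply, smul_eq_mul, mul_one]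
    split_ifs with h
    · symm
      apply Finset.prod_eq_one
      intro c hc
      rw [h]
      exact inv_mul_cancel₀ (sub_ne_zero.2 (Finset.ne_of_mem_erase hc).symm)
    · symm
      apply Finset.prod_eq_zero (i := x k)
      · simp [h]
      · simp
  have h1 : (1 : Fin n → K) ∈ stab B := by
    intro e he; simpa using he
  rw [key]
  apply Finset.prod_induction _ (fun y => y ∈ stab B)
  · intro a b ha hb e he
    rw [mul_assoc]
    exact ha _ (hb _ he)
  · exact h1
  · intro c hc
    exact (stab B).smul_mem _ ((stab B).sub_mem hx ((stab B).smul_mem _ h1))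

theorem mulLeft_inj (e : Fin n → K) (he : ∀ i, e i ≠ 0) :
    Function.Injective (LinearMap.mulLeft K e) := by
  intro a b hab
  funext i
  have := congrFun hab i
  simpa [he i] using this

theorem finrank_map_mul (e : Fin n → K) (he : ∀ i, e i ≠ 0) (A : Submodule K (Fin n → K)) :
    Module.finrank K (A.map (LinearMap.mulLeft K e)) = Module.finrank K A :=
  (Submodule.equivMapOfInjective _ (mulLeft_inj e he) A).finrank_eq.symm

theorem kneser_aux [Infinite K] (M : Submodule K (Fin n → K)) (d : ℕ) :
    ∀ A B : Submodule K (Fin n → K), Module.finrank K A ≤ d → (1 : Fin n → K) ∈ A →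
      (∀ i, ∃ v ∈ B, v i ≠ 0) → (∀ a ∈ A, ∀ b ∈ B, a * b ∈ M) →
      Module.finrank K M + 1 < Module.finrank K A + Module.finrank K B →
      ∃ S : Finset (Fin n), S ≠ ∅ ∧ S ≠ Finset.univ ∧ ∀ b ∈ B, charVec K S * b ∈ M := by
  induction d with
  | zero =>
    intro A B hd h1 hB hM hlt
    have hBM : B ≤ M := fun b hb => by simpa using hM 1 h1 b hb
    have := Submodule.finrank_mono hBM
    omega
  | succ d ih =>
    intro A B hd h1 hB hM hlt
    have hBM : B ≤ M := fun b hb => by simpa using hM 1 h1 b hb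
    have hBMr := Submodule.finrank_mono hBM
    by_cases hall : ∀ e ∈ B, (∀ i, e i ≠ 0) → ∀ a ∈ A, e * a ∈ B
    · -- A stabilises B
      let P : Unit → Submodule K (Fin n → K) := fun _ =>
        { carrier := {e | ∀ a ∈ A, e * a ∈ B}
          add_mem' := fun {x y} hx hy a ha => by
            rw [add_mul]; exact B.add_mem (hx a ha) (hy a ha)
          zero_mem' := fun a ha => by simp
          smul_mem' := fun c {x} hx a ha => by
            rw [smul_mul_assoc]; exact B.smul_mem c (hx a ha) }
      obtain ⟨_, hP⟩ := cover_unit B hB P (fun e he h0 => ⟨(), hall e he h0⟩)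
      have hst : ∀ a ∈ A, a ∈ stab B := fun a ha b hb => by
        rw [mul_comm]; exact hP hb a ha
      have hnc : ∃ x ∈ A, ∃ i j, x i ≠ x j := by
        by_contra hcon
        push Not at hcon
        have hle : A ≤ Submodule.span K {(1 : Fin n → K)} := by
          intro x hx
          rw [Submodule.mem_span_singleton]
          rcases isEmpty_or_nonempty (Fin n) with hn | ⟨⟨i⟩⟩
          · exact ⟨0, Subsingleton.elim _ _⟩
          · exact ⟨x i, by funext j; simpa using hcon x hx i j⟩
        have h2 := Submodule.finrank_mono hle
        have h3 := finrank_span_le_card (R := K) {(1 : Fin n → K)}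
        simp only [Set.toFinset_singleton, Finset.card_singleton] at h3
        omega
      obtain ⟨x, hx, i, j, hij⟩ := hnc
      obtain ⟨S, hi, hj, hS⟩ := stab_exists_idem B x (hst x hx) i j hij
      refine ⟨S, ?_, ?_, fun b hb => hBM (hS b hb)⟩
      · rintro rfl; simp at hi
      · rintro rfl; simp at hj
    · push Not at hall
      obtain ⟨e, heB, he0, a, haA, hea⟩ := hall
      set L := LinearMap.mulLeft K e with hL
      have hmapinf : A.map L ⊓ B = (A ⊓ B.comap L).map L := by
        ext y
        constructor
        · rintro ⟨⟨z, hz, rfl⟩, hy⟩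
          exact ⟨z, ⟨hz, hy⟩, rfl⟩
        · rintro ⟨z, ⟨hz, hz'⟩, rfl⟩
          exact ⟨⟨z, hz, rfl⟩, hz'⟩
      have hdim := Submodule.finrank_sup_add_finrank_inf_eq (A.map L) B
      rw [hmapinf, finrank_map_mul e he0, finrank_map_mul e he0] at hdim
      have hlt' : A ⊓ B.comap L < A := by
        refine lt_of_le_of_ne inf_le_left (fun h => hea ?_)
        have : a ∈ A ⊓ B.comap L := by rw [h]; exact haA
        exact this.2
      have hr := Submodule.finrank_lt_finrank_of_lt hlt'
      obtain ⟨S, hS1, hS2, hS⟩ := ih (A ⊓ B.comap L) (A.map L ⊔ B) (by omega)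
        ⟨h1, by simpa [hL] using heB⟩
        (fun i => by
          obtain ⟨v, hv, hv0⟩ := hB i
          exact ⟨v, Submodule.mem_sup_right hv, hv0⟩)
        (by
          rintro x ⟨hxA, hxB⟩ y hy
          obtain ⟨y1, ⟨z, hz, rfl⟩, y2, hy2, rfl⟩ := Submodule.mem_sup.1 hy
          rw [mul_add]
          refine M.add_mem ?_ (hM x hxA y2 hy2)
          have h5 : z * (e * x) ∈ M := hM z hz _ hxB
          have h6 : x * L z = z * (e * x) := by
            rw [hL, LinearMap.mulLeft_apply]; ring
          rw [h6]; exact h5)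
        (by omega)
      exact ⟨S, hS1, hS2, fun b hb => hS b (Submodule.mem_sup_right hb)⟩

theorem kneser_code [Infinite K] (M A B : Submodule K (Fin n → K))
    (hA : ∀ i, ∃ v ∈ A, v i ≠ 0) (hB : ∀ i, ∃ v ∈ B, v i ≠ 0)
    (hM : ∀ a ∈ A, ∀ b ∈ B, a * b ∈ M)
    (hlt : Module.finrank K M + 1 < Module.finrank K A + Module.finrank K B) :
    ∃ S : Finset (Fin n), S ≠ ∅ ∧ S ≠ Finset.univ ∧
      ∀ a ∈ A, ∀ b ∈ B, charVec K S * (a * b) ∈ M := by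
  let P : {S : Finset (Fin n) // S ≠ ∅ ∧ S ≠ Finset.univ} → Submodule K (Fin n → K) := fun S =>
    { carrier := {a | ∀ b ∈ B, charVec K S.1 * (a * b) ∈ M}
      add_mem' := fun {x y} hx hy b hb => by
        rw [add_mul, mul_add]; exact M.add_mem (hx b hb) (hy b hb)
      zero_mem' := fun b hb => by simp
      smul_mem' := fun c {x} hx b hb => by
        rw [smul_mul_assoc, mul_smul_comm]; exact M.smul_mem c (hx b hb) }
  obtain ⟨S, hS⟩ := cover_unit A hA P (by
    intro x hx hx0
    have hxi : ∀ i, x⁻¹ i ≠ 0 := fun i => inv_ne_zero (hx0 i)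
    have hxx : x⁻¹ * x = 1 := by
      funext i; exact inv_mul_cancel₀ (hx0 i)
    obtain ⟨S, h1, h2, h3⟩ := kneser_aux M _ (A.map (LinearMap.mulLeft K x⁻¹))
      (B.map (LinearMap.mulLeft K x)) le_rfl ⟨x, hx, hxx⟩
      (fun i => by
        obtain ⟨v, hv, hv0⟩ := hB i
        exact ⟨x * v, ⟨v, hv, rfl⟩, mul_ne_zero (hx0 i) hv0⟩)
      (by
        rintro _ ⟨a, ha, rfl⟩ _ ⟨b, hb, rfl⟩
        have : LinearMap.mulLeft K x⁻¹ a * LinearMap.mulLeft K x b = a * b := by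
          simp only [LinearMap.mulLeft_apply]
          calc x⁻¹ * a * (x * b) = (x⁻¹ * x) * (a * b) := by ring
            _ = a * b := by rw [hxx, one_mul]
        rw [this]; exact hM a ha b hb)
      (by rw [finrank_map_mul _ hxi, finrank_map_mul _ hx0]; exact hlt)
    exact ⟨⟨S, h1, h2⟩, fun b hb => h3 (x * b) ⟨b, hb, rfl⟩⟩)
  exact ⟨S.1, S.2.1, S.2.2, fun a ha b hb => hS ha b hb⟩

end helpers

section basechange

variable {F K : Type*} [Field F] [Field K] [Algebra F K] {n : ℕ}

/-- Coordinatewise inclusion. -/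
def phi (F K : Type*) [Field F] [Field K] [Algebra F K] (n : ℕ) (v : Fin n → F) : Fin n → K :=
  fun i => algebraMap F K (v i)

/-- Scalar extension of a code. -/
def ext (K : Type*) [Field K] [Algebra F K] (U : Submodule F (Fin n → F)) :
    Submodule K (Fin n → K) :=
  Submodule.span K (phi F K n '' (U : Set (Fin n → F)))

theorem phi_mem_ext {U : Submodule F (Fin n → F)} {u : Fin n → F} (hu : u ∈ U) :
    phi F K n u ∈ ext K U := Submodule.subset_span ⟨u, hu, rfl⟩

theorem phi_mul (u v : Fin n → F) : phi F K n (u * v) = phi F K n u * phi F K n v := by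
  funext i; simp [phi]

theorem phi_charVec (S : Finset (Fin n)) : phi F K n (charVec F S) = charVec K S := by
  funext i; simp [phi, charVec, apply_ite (algebraMap F K)]

/-- Extension of a functional. -/
def extFun (K : Type*) [Field K] [Algebra F K] (f : (Fin n → F) →ₗ[F] F) :
    (Fin n → K) →ₗ[K] K :=
  ∑ i, (algebraMap F K (f (Pi.single i 1))) • LinearMap.proj (R := K) (φ := fun _ => K) i

theorem extFun_phi (f : (Fin n → F) →ₗ[F] F) (v : Fin n → F) :
    extFun K f (phi F K n v) = algebraMap F K (f v) := by
  have : f v = ∑ i, v i * f (Pi.single i 1) := by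
    rw [f.pi_apply_eq_sum_univ]
    simp only [smul_eq_mul]
    refine Finset.sum_congr rfl fun i _ => ?_
    congr 2
    funext j
    simp [Pi.single_apply, eq_comm]
  rw [this]
  simp only [extFun, phi, LinearMap.sum_apply, LinearMap.smul_apply, LinearMap.proj_apply,
    smul_eq_mul, map_sum, map_mul]
  exact Finset.sum_congr rfl fun i _ => mul_comm _ _

theorem mem_of_phi_mem (U : Submodule F (Fin n → F)) (u : Fin n → F)
    (h : phi F K n u ∈ ext K U) : u ∈ U := by
  by_contra hu
  obtain ⟨f, hf, hU⟩ := Submodule.exists_le_ker_of_notMem hu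
  have hle : ext K U ≤ LinearMap.ker (extFun K f) := by
    refine Submodule.span_le.2 ?_
    rintro _ ⟨v, hv, rfl⟩
    have : f v = 0 := hU hv
    simp [extFun_phi, this]
  have h0 : extFun K f (phi F K n u) = 0 := hle h
  rw [extFun_phi] at h0
  exact hf (by simpa using h0)

theorem phi_add (u v : Fin n → F) : phi F K n (u + v) = phi F K n u + phi F K n v := by
  funext i; simp [phi]

theorem phi_smul (c : F) (v : Fin n → F) :
    phi F K n (c • v) = algebraMap F K c • phi F K n v := by
  funext i; simp [phi]

theorem phi_zero : phi F K n 0 = 0 := by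
  funext i; simp [phi]

theorem ext_eq_span (U : Submodule F (Fin n → F)) (s : Set (Fin n → F))
    (hs : Submodule.span F s = U) : ext K U = Submodule.span K (phi F K n '' s) := by
  apply le_antisymm
  · refine Submodule.span_le.2 ?_
    rintro _ ⟨v, hv, rfl⟩
    rw [← hs] at hv
    refine Submodule.span_induction (p := fun v _ => phi F K n v ∈ Submodule.span K (phi F K n '' s))
      ?_ ?_ ?_ ?_ hv
    · intro x hx; exact Submodule.subset_span ⟨x, hx, rfl⟩
    · rw [phi_zero]; exact Submodule.zero_mem _
    · intro x y _ _ hx hy; rw [phi_add]; exact Submodule.add_mem _ hx hy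
    · intro c x _ hx; rw [phi_smul]; exact Submodule.smul_mem _ _ hx
  · refine Submodule.span_mono (Set.image_mono ?_)
    rw [← hs]; exact Submodule.subset_span

theorem phi_linInd {ι : Type*} [Finite ι] (b : ι → Fin n → F) (hb : LinearIndependent F b) :
    LinearIndependent K (fun i => phi F K n (b i)) := by
  classical
  have := Fintype.ofFinite ι
  obtain ⟨g, hg⟩ := LinearMap.exists_leftInverse_of_injective
    (Finsupp.linearCombination F b) (LinearMap.ker_eq_bot.2 hb)
  have hdual : ∀ i j, (Finsupp.lapply i ∘ₗ g) (b j) = if j = i then 1 else 0 := by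
    intro i j
    have h := LinearMap.congr_fun hg (Finsupp.single j 1)
    simp at h
    simp [h, Finsupp.single_apply]
  rw [Fintype.linearIndependent_iff]
  intro c hc i
  have h := congrArg (extFun K (Finsupp.lapply i ∘ₗ g)) hc
  simp only [map_sum, map_smul, extFun_phi, hdual, map_zero] at h
  simpa [apply_ite (algebraMap F K)] using h

theorem finrank_ext (U : Submodule F (Fin n → F)) :
    Module.finrank K (ext K U) = Module.finrank F U := by
  let b := Module.finBasis F U
  have hs : Submodule.span F (Set.range (fun i => (b i : Fin n → F))) = U := by
    have := congrArg (Submodule.map U.subtype) b.span_eq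
    rw [Submodule.map_span, ← Set.range_comp] at this
    simpa [Function.comp_def] using this
  have hli : LinearIndependent F (fun i => (b i : Fin n → F)) :=
    b.linearIndependent.map' U.subtype U.ker_subtype
  rw [ext_eq_span U _ hs, ← Set.range_comp]
  have := finrank_span_eq_card (phi_linInd (K := K) _ hli)
  simpa [Function.comp_def] using this

end basechange

section powers

variable {F : Type*} [Field F] {n : ℕ}

theorem mul_mem_schurMul {C D : Submodule F (Fin n → F)} {c d : Fin n → F}
    (hc : c ∈ C) (hd : d ∈ D) : c * d ∈ schurMul C D :=
  Submodule.subset_span ⟨c, hc, d, hd, rfl⟩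

theorem schurMul_le {C D E : Submodule F (Fin n → F)}
    (h : ∀ c ∈ C, ∀ d ∈ D, c * d ∈ E) : schurMul C D ≤ E := by
  refine Submodule.span_le.2 ?_
  rintro _ ⟨c, hc, d, hd, rfl⟩
  exact h c hc d hd

/-- Multiplication of spans, tested on generators. -/
theorem span_mul_mem {s t : Set (Fin n → F)} {E : Submodule F (Fin n → F)}
    (h : ∀ a ∈ s, ∀ b ∈ t, a * b ∈ E) :
    ∀ a ∈ Submodule.span F s, ∀ b ∈ Submodule.span F t, a * b ∈ E := by
  intro a ha b hb
  have := Submodule.mul_mem_mul ha hb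
  rw [Submodule.span_mul_span] at this
  refine (Submodule.span_le.2 ?_) this
  rintro _ ⟨a, ha, b, hb, rfl⟩
  exact h a ha b hb

theorem stab_schurPow_succ (V : Submodule F (Fin n → F)) (k : ℕ) :
    stab (schurPow V k) ≤ stab (schurPow V (k + 1)) := by
  intro x hx e he
  have : schurPow V (k + 1) ≤ (schurPow V (k + 1)).comap (LinearMap.mulLeft F x) := by
    apply schurMul_le
    intro c hc d hd
    have : x * c * d ∈ schurPow V (k + 1) := mul_mem_schurMul (hx c hc) hd
    simpa [mul_assoc] using this
  exact this he

theorem stab_schurPow_mono (V : Submodule F (Fin n → F)) {k l : ℕ} (h : k ≤ l) :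
    stab (schurPow V k) ≤ stab (schurPow V l) :=
  monotone_nat_of_le_succ (f := fun k => stab (schurPow V k)) (stab_schurPow_succ V) h

/-- For `V` spanned by idempotents, the powers increase. -/
theorem schurPow_succ (V : Submodule F (Fin n → F)) (s : Set (Fin n → F))
    (hs : ∀ x ∈ s, x * x = x) (hV : V = Submodule.span F s) (k : ℕ) :
    schurPow V k ≤ schurPow V (k + 1) := by
  induction k with
  | zero =>
    show V ≤ schurMul V V
    conv_lhs => rw [hV]
    refine Submodule.span_le.2 fun x hx => ?_
    have hxV : x ∈ V := by rw [hV]; exact Submodule.subset_span hx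
    have := mul_mem_schurMul hxV hxV
    rwa [hs x hx] at this
  | succ k ih =>
    exact schurMul_le fun c hc d hd => mul_mem_schurMul (ih hc) hd

theorem schurPow_mono (V : Submodule F (Fin n → F)) (s : Set (Fin n → F))
    (hs : ∀ x ∈ s, x * x = x) (hV : V = Submodule.span F s) {k l : ℕ} (h : k ≤ l) :
    schurPow V k ≤ schurPow V l :=
  monotone_nat_of_le_succ (f := fun k => schurPow V k) (schurPow_succ V s hs hV) h

theorem prod_mem_schurPow (V : Submodule F (Fin n → F)) (T : Finset (Fin n → F))
    (hT : ∀ x ∈ T, x ∈ V) (k : ℕ) (hk : T.card = k + 1) : ∏ x ∈ T, x ∈ schurPow V k := by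
  classical
  induction k generalizing T with
  | zero =>
    obtain ⟨a, rfl⟩ := Finset.card_eq_one.1 hk
    simpa [schurPow] using hT
  | succ k ih =>
    obtain ⟨a, T', ha, rfl, hc⟩ := Finset.card_eq_succ.1 hk
    rw [Finset.prod_insert ha, mul_comm]
    exact mul_mem_schurMul (ih T' (fun x hx => hT x (Finset.mem_insert_of_mem hx)) hc)
      (hT a (Finset.mem_insert_self _ _))

/-- Stabilisation of the powers. -/
theorem le_stab_of_finrank_le (V : Submodule F (Fin n → F)) (s : Set (Fin n → F))
    (hs : ∀ x ∈ s, x * x = x) (hV : V = Submodule.span F s) (t : ℕ)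
    (ht : Module.finrank F V ≤ t + 1) : V ≤ stab (schurPow V t) := by
  classical
  obtain ⟨b, hbs, hbspan, hbli⟩ := exists_linearIndependent F s
  have hbV : V = Submodule.span F b := by rw [hV, hbspan]
  have hfin : b.Finite := hbli.setFinite
  obtain ⟨b, rfl⟩ := hfin.exists_finset_coe
  have hcard : b.card = Module.finrank F V := by
    rw [hbV]; exact (finrank_span_finset_eq_card hbli).symm
  let Q : Set (Fin n → F) := {y | ∃ T ⊆ b, T.Nonempty ∧ y = ∏ x ∈ T, x}
  have hmul : ∀ a ∈ Submodule.span F Q, ∀ v ∈ V, a * v ∈ Submodule.span F Q := by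
    rw [hbV]
    apply span_mul_mem
    rintro _ ⟨T, hT, hne, rfl⟩ x hx
    refine Submodule.subset_span ⟨insert x T, ?_, by simp, ?_⟩
    · exact Finset.insert_subset hx hT
    · by_cases hxT : x ∈ T
      · rw [Finset.insert_eq_of_mem hxT, ← Finset.mul_prod_erase T (fun x => x) hxT]
        have := hs x (hbs hx)
        rw [mul_right_comm, this]
      · rw [Finset.prod_insert hxT, mul_comm]
  have hle : ∀ k, schurPow V k ≤ Submodule.span F Q := by
    intro k
    induction k with
    | zero =>
      show V ≤ _
      conv_lhs => rw [hbV]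
      refine Submodule.span_mono fun x hx => ?_
      exact ⟨{x}, by simpa using hx, by simp, by simp⟩
    | succ k ih => exact schurMul_le fun c hc d hd => hmul c (ih hc) d hd
  have hge : Submodule.span F Q ≤ schurPow V t := by
    refine Submodule.span_le.2 ?_
    rintro _ ⟨T, hT, hne, rfl⟩
    have h1 := Finset.card_le_card hT
    have h2 := hne.card_pos
    refine schurPow_mono V s hs hV (k := T.card - 1) (by omega)
      (prod_mem_schurPow V T (fun x hx => ?_) _ (by omega))
    rw [hbV]; exact Submodule.subset_span (hT hx)
  intro v hv e he
  rw [mul_comm]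
  exact hge (hmul e (hle t he) v hv)

theorem kneser_step (K : Type*) [Field K] [Algebra F K] [Infinite K]
    (V : Submodule F (Fin n → F)) (hsupp : ∀ i, ∃ v ∈ V, v i ≠ 0) (k : ℕ)
    (hVk : V ≤ schurPow V k)
    (hlt : Module.finrank F (schurPow V (k + 1)) + 1 <
      Module.finrank F V + Module.finrank F (schurPow V k)) :
    ∃ S : Finset (Fin n), S ≠ ∅ ∧ S ≠ Finset.univ ∧
      charVec F S ∈ stab (schurPow V (k + 1)) := by
  have hsuppK : ∀ U : Submodule F (Fin n → F), V ≤ U → ∀ i, ∃ v ∈ ext K U, v i ≠ 0 := by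
    intro U hU i
    obtain ⟨v, hv, hv0⟩ := hsupp i
    refine ⟨phi F K n v, phi_mem_ext (hU hv), ?_⟩
    simpa [phi] using hv0
  obtain ⟨S, hS1, hS2, hS⟩ := kneser_code (ext K (schurPow V (k + 1)))
    (ext K (schurPow V k)) (ext K V) (hsuppK _ hVk) (hsuppK _ le_rfl)
    (by
      apply span_mul_mem
      rintro _ ⟨u, hu, rfl⟩ _ ⟨v, hv, rfl⟩
      rw [← phi_mul]
      exact phi_mem_ext (mul_mem_schurMul hu hv))
    (by rw [finrank_ext, finrank_ext, finrank_ext]; omega)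
  refine ⟨S, hS1, hS2, ?_⟩
  have hle : schurPow V (k + 1) ≤
      (schurPow V (k + 1)).comap (LinearMap.mulLeft F (charVec F S)) := by
    apply schurMul_le
    intro c hc d hd
    have h := hS (phi F K n c) (phi_mem_ext hc) (phi F K n d) (phi_mem_ext hd)
    have h2 : charVec K S * (phi F K n c * phi F K n d) =
        phi F K n (charVec F S * (c * d)) := by
      rw [phi_mul, phi_mul, phi_charVec]
    rw [h2] at h
    rw [Submodule.mem_comap, LinearMap.mulLeft_apply]
    exact mem_of_phi_mem (K := K) _ _ h
  exact fun e he => hle he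

end powers

/-- if the family spans `V` over `F_p`, contains two distinct nonempty
sets, and `V^⟨t+1⟩` has trivial stabiliser, then `dim V > t+1` and
`dim V^⟨t+1⟩ > (t+1)²`.  (Recall `schurPow V t = V^⟨t+1⟩`.) -/
theorem statement8 (p n t : ℕ) [Fact p.Prime] (ht : 0 < t)
    (𝓕 : Finset (Finset (Fin n)))
    (htwo : ∃ A ∈ 𝓕, ∃ B ∈ 𝓕, A ≠ B ∧ A ≠ ∅ ∧ B ≠ ∅)
    (V : Submodule (ZMod p) (Fin n → ZMod p))
    (hV : V = Submodule.span (ZMod p) (charVec (ZMod p) '' (𝓕 : Set (Finset (Fin n)))))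
    (hst : Module.finrank (ZMod p) ↥(stab (schurPow V t)) = 1) :
    t + 1 < Module.finrank (ZMod p) ↥V ∧
      (t + 1) ^ 2 < Module.finrank (ZMod p) ↥(schurPow V t) := by
  classical
  have hidem : ∀ x ∈ charVec (ZMod p) '' (𝓕 : Set (Finset (Fin n))), x * x = x := by
    rintro _ ⟨A, _, rfl⟩
    funext i
    simp [charVec]
  have hmemV : ∀ A ∈ 𝓕, charVec (ZMod p) A ∈ V := fun A hA => by
    rw [hV]; exact Submodule.subset_span ⟨A, hA, rfl⟩
  obtain ⟨A, hA, B, hB, hAB, hA0, hB0⟩ := htwo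
  obtain ⟨a, haA⟩ := Finset.nonempty_iff_ne_empty.2 hA0
  have htriv : ∀ S : Finset (Fin n), charVec (ZMod p) S ∈ stab (schurPow V t) →
      S = ∅ ∨ S = Finset.univ := by
    intro S hS
    have h1 : (1 : Fin n → ZMod p) ∈ stab (schurPow V t) := fun e he => by simpa using he
    have hne : (⟨1, h1⟩ : stab (schurPow V t)) ≠ 0 := by
      intro h
      have h2 := congrFun (congrArg Subtype.val h) a
      simp at h2
    obtain ⟨c, hc⟩ := (finrank_eq_one_iff_of_nonzero' _ hne).1 hst ⟨_, hS⟩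
    have hc' : ∀ i, c = charVec (ZMod p) S i := fun i => by
      have := congrFun (congrArg Subtype.val hc) i
      simpa using this
    rcases S.eq_empty_or_nonempty with h | ⟨j, hj⟩
    · exact Or.inl h
    · right
      have hcj : c = 1 := by rw [hc' j]; simp [charVec, hj]
      ext i
      have := hc' i
      rw [hcj] at this
      by_contra hi
      simp at hi
      simp [charVec, hi] at this
  have hpart1 : t + 1 < Module.finrank (ZMod p) V := by
    by_contra hcon
    push Not at hcon
    have hle := le_stab_of_finrank_le V _ hidem hV t hcon
    have h1 := (htriv A (hle (hmemV A hA))).resolve_left hA0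
    have h2 := (htriv B (hle (hmemV B hB))).resolve_left hB0
    exact hAB (h1.trans h2.symm)
  refine ⟨hpart1, ?_⟩
  have hVk : ∀ k, V ≤ schurPow V k := fun k =>
    schurPow_mono V _ hidem hV (Nat.zero_le k)
  have hsupp : ∀ i, ∃ v ∈ V, v i ≠ 0 := by
    intro i
    by_contra hcon
    push Not at hcon
    have hz : ∀ k, ∀ v ∈ schurPow V k, v i = 0 := by
      intro k
      have hle : schurPow V k ≤ hyp (ZMod p) i := by
        cases k with
        | zero => exact fun v hv => (mem_hyp i v).2 (hcon v hv)
        | succ k => exact schurMul_le fun c _ d hd => (mem_hyp i _).2 (by simp [hcon d hd])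
      exact fun v hv => (mem_hyp i v).1 (hle hv)
    have hmem : charVec (ZMod p) {i} ∈ stab (schurPow V t) := by
      intro e he
      have : charVec (ZMod p) {i} * e = 0 := by
        funext j
        by_cases hj : j = i
        · subst hj; simp [hz t e he]
        · simp [charVec, hj]
      rw [this]; exact Submodule.zero_mem _
    have hu := (htriv _ hmem).resolve_left (by simp)
    have hai : a = i := by
      have : a ∈ ({i} : Finset (Fin n)) := by rw [hu]; simp
      simpa using this
    have := hcon _ (hmemV A hA)
    rw [← hai] at this
    simp [charVec, haA] at this
  have hstep : ∀ k, k + 1 ≤ t → Module.finrank (ZMod p) V +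
      Module.finrank (ZMod p) (schurPow V k) ≤
      Module.finrank (ZMod p) (schurPow V (k + 1)) + 1 := by
    intro k hk
    by_contra hcon
    push Not at hcon
    obtain ⟨S, hS1, hS2, hmem⟩ := kneser_step (AlgebraicClosure (ZMod p)) V hsupp k (hVk k) hcon
    rcases htriv S (stab_schurPow_mono V hk hmem) with h | h
    · exact hS1 h
    · exact hS2 h
  have hgrow : ∀ k, k ≤ t → (k + 1) * Module.finrank (ZMod p) V ≤
      Module.finrank (ZMod p) (schurPow V k) + k := by
    intro k
    induction k with
    | zero => intro _; simp [schurPow]; exact le_rfl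
    | succ k ih =>
      intro hk
      have h1 := ih (by omega)
      have h2 := hstep k hk
      have h3 : (k + 1 + 1) * Module.finrank (ZMod p) V =
        (k + 1) * Module.finrank (ZMod p) V + Module.finrank (ZMod p) V := by ring
      omega
  have hfin := hgrow t le_rfl
  have h4 : (t + 1) * (t + 2) ≤ (t + 1) * Module.finrank (ZMod p) V :=
    Nat.mul_le_mul_left _ hpart1
  nlinarith
end

section
/- Let p ≥ 3 be prime and F ⊆ {0,1}^n contain at least two non-zero sets. Let V be the F_p-span of F and suppose dim St(V^⟨3⟩) = 1. Then |V ∩ {0,1}^n| ≤ 2^(dim V − 1). -/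
open Submodule

section helpers

variable {K : Type*} [Field K]

/-- The embedding of `ZMod 2` as `{0,1}` into a field. -/
def liftBit (K : Type*) [Field K] (a : ZMod 2) : K := if a = 0 then 0 else 1

lemma bit_cases (a : ZMod 2) : a = 0 ∨ a = 1 := by
  revert a; decide

lemma liftBit_zero : liftBit K 0 = 0 := by simp [liftBit]

lemma liftBit_one : liftBit K 1 = 1 := by
  have : (1 : ZMod 2) ≠ 0 := by decide
  simp [liftBit]

lemma liftBit_add (a b : ZMod 2) :
    liftBit K (a + b) = liftBit K a + (1 - 2 * liftBit K a) * liftBit K b := by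
  rcases bit_cases a with rfl | rfl <;> rcases bit_cases b with rfl | rfl
  · simp [liftBit_zero]
  · simp [liftBit_zero]
  · simp [liftBit_zero]
  · have : (1 + 1 : ZMod 2) = 0 := by decide
    rw [this, liftBit_zero, liftBit_one]; ring

/-- The value in one column of the 0/1 combination `σ` of the rows. -/
noncomputable def colVal {κ : Type*} [Fintype κ] (f : κ → K) (σ : κ → ZMod 2) : K :=
  ∑ k, liftBit K (σ k) * f k

lemma colVal_add_single {κ : Type*} [Fintype κ] [DecidableEq κ] (f : κ → K)
    (σ : κ → ZMod 2) (i : κ) (a : ZMod 2) :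
    colVal f (σ + Pi.single i a) =
      colVal f σ + liftBit K a * ((1 - 2 * liftBit K (σ i)) * f i) := by
  unfold colVal
  rw [← sub_eq_iff_eq_add', ← Finset.sum_sub_distrib, Finset.sum_eq_single i]
  · simp only [Pi.add_apply, Pi.single_eq_same, liftBit_add]; ring
  · intro b _ hb
    simp [Pi.single_eq_of_ne hb]
  · simp

lemma sgn_sq (a : ZMod 2) : (1 - 2 * liftBit K a) * (1 - 2 * liftBit K a) = 1 := by
  rcases bit_cases a with rfl | rfl
  · simp [liftBit_zero]
  · rw [liftBit_one]; ring

/-- averaging over a group -/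
lemma exists_dense {G τ : Type*} [AddCommGroup G] [Fintype G] [Fintype τ] [DecidableEq G]
    (Y : Finset G) (hY : Fintype.card G < 2 * Y.card) (t : τ → G) :
    ∃ σ : G, Fintype.card τ ≤ 2 * (Finset.univ.filter (fun x => σ + t x ∈ Y)).card ∧
      (Nonempty τ → Fintype.card τ < 2 * (Finset.univ.filter (fun x => σ + t x ∈ Y)).card) := by
  classical
  by_cases hτ : Nonempty τ
  swap
  · have := not_nonempty_iff.1 hτ
    exact ⟨0, by simp, fun h => absurd h hτ⟩
  by_contra hcon
  push Not at hcon
  have h1 : ∀ σ : G, 2 * (Finset.univ.filter (fun x => σ + t x ∈ Y)).card ≤ Fintype.card τ := by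
    intro σ
    by_contra h
    have := hcon σ (by omega)
    omega
  have h2 : ∑ σ : G, (Finset.univ.filter (fun x => σ + t x ∈ Y)).card
      = Fintype.card τ * Y.card := by
    simp only [Finset.card_filter]
    rw [Finset.sum_comm]
    have : ∀ x : τ, ∑ σ : G, (if σ + t x ∈ Y then (1 : ℕ) else 0) = Y.card := by
      intro x
      rw [Fintype.sum_equiv (Equiv.addRight (t x)) _ (fun σ => if σ ∈ Y then (1 : ℕ) else 0)
        (by intro σ; simp only [Equiv.coe_addRight]; congr)]
      simp
    rw [Finset.sum_congr rfl (fun x _ => this x)]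
    simp
  have h3 : 2 * (Fintype.card τ * Y.card) ≤ Fintype.card G * Fintype.card τ := by
    rw [← h2, Finset.mul_sum]
    calc _ ≤ ∑ _σ : G, Fintype.card τ := Finset.sum_le_sum (fun σ _ => h1 σ)
      _ = _ := by simp
  have h4 : 0 < Fintype.card τ := Fintype.card_pos
  nlinarith

lemma sq_forbid (h2 : (2 : K) ≠ 0) (s α β : K) (hα : α ≠ 0) (hβ : β ≠ 0) :
    ∃ a b : ZMod 2, ¬ (s + liftBit K a * α + liftBit K b * β = 0 ∨
      s + liftBit K a * α + liftBit K b * β = 1) := by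
  by_contra hcon
  push Not at hcon
  have h00 := hcon 0 0
  have h01 := hcon 0 1
  have h10 := hcon 1 0
  have h11 := hcon 1 1
  simp only [liftBit_zero, liftBit_one, zero_mul, one_mul, add_zero] at h00 h01 h10 h11
  grind

lemma diag_forbid (h2 : (2 : K) ≠ 0) (s α β : K) (hα : α = 1 ∨ α = -1) (h : α = β) :
    (∃ a : ZMod 2, ¬ (s + liftBit K a * α + liftBit K a * β = 0 ∨
      s + liftBit K a * α + liftBit K a * β = 1)) ∨
    (∀ a : ZMod 2, ¬ (s + liftBit K a * α + liftBit K (a + 1) * β = 0 ∨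
      s + liftBit K a * α + liftBit K (a + 1) * β = 1)) := by
  have e : (1 + 1 : ZMod 2) = 0 := by decide
  by_contra hcon
  push Not at hcon
  obtain ⟨hcon, a, ha⟩ := hcon
  have h00 := hcon 0
  have h11 := hcon 1
  rcases bit_cases a with rfl | rfl <;> (try rw [e] at ha) <;>
  simp only [liftBit_zero, liftBit_one, zero_mul, one_mul, add_zero, zero_add] at h00 h11 ha <;>
  clear hcon e <;> grind

lemma antidiag_forbid (h2 : (2 : K) ≠ 0) (s α β : K) (hα : α = 1 ∨ α = -1) (h : α = -β) :
    (∃ a : ZMod 2, ¬ (s + liftBit K a * α + liftBit K (a + 1) * β = 0 ∨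
      s + liftBit K a * α + liftBit K (a + 1) * β = 1)) ∨
    (∀ a : ZMod 2, ¬ (s + liftBit K a * α + liftBit K a * β = 0 ∨
      s + liftBit K a * α + liftBit K a * β = 1)) := by
  have e : (1 + 1 : ZMod 2) = 0 := by decide
  by_contra hcon
  push Not at hcon
  obtain ⟨hcon, a, ha⟩ := hcon
  have h00 := hcon 0
  have h11 := hcon 1
  rw [e] at h11
  rcases bit_cases a with rfl | rfl <;>
  simp only [liftBit_zero, liftBit_one, zero_mul, one_mul, add_zero, zero_add] at h00 h11 ha <;>
  clear hcon e <;> grind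

lemma three_edges : ∀ a1 a2 b1 b3 c2 c3 : ZMod 2,
    (Finset.univ.filter (fun x : ZMod 2 × ZMod 2 × ZMod 2 =>
      ¬ (x.1 = a1 ∧ x.2.1 = a2) ∧ ¬ (x.1 = b1 ∧ x.2.2 = b3) ∧
      ¬ (x.2.1 = c2 ∧ x.2.2 = c3))).card ≤ 4 := by
  decide

lemma two_corners : ∀ a b : ZMod 2,
    (Finset.univ.filter (fun x : ZMod 2 × ZMod 2 =>
      ¬ (x.1 = a ∧ x.2 = a) ∧ ¬ (x.1 = b ∧ x.2 = b + 1))).card ≤ 2 := by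
  decide

lemma no_diag :
    (Finset.univ.filter (fun x : ZMod 2 × ZMod 2 =>
      ∀ a, ¬ (x.1 = a ∧ x.2 = a))).card ≤ 2 := by
  decide

lemma no_antidiag :
    (Finset.univ.filter (fun x : ZMod 2 × ZMod 2 =>
      ∀ a, ¬ (x.1 = a ∧ x.2 = a + 1))).card ≤ 2 := by
  decide

variable {κ C : Type*} [Fintype κ] [DecidableEq κ]

/-- `f c k` is the entry of row `k` in column `c`. -/
def Good (f : C → κ → K) (Y : Finset (κ → ZMod 2)) : Prop :=
  2 ^ Fintype.card κ < 2 * Y.card ∧ ∀ σ ∈ Y, ∀ c, colVal (f c) σ = 0 ∨ colVal (f c) σ = 1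

lemma Good.single {f : C → κ → K} {Y : Finset (κ → ZMod 2)}
    (h : Good f Y) (c : C) (i : κ) : f c i = 0 ∨ f c i = 1 ∨ f c i = -1 := by
  obtain ⟨σ, -, hσ⟩ := exists_dense Y (by simpa using h.1) (fun a : ZMod 2 => Pi.single i a)
  have hσ := hσ inferInstance
  have hall : ∀ a : ZMod 2, σ + Pi.single i a ∈ Y := by
    intro a
    have hle : (Finset.univ : Finset (ZMod 2)).card ≤
        (Finset.univ.filter (fun x : ZMod 2 => σ + Pi.single i x ∈ Y)).card := by
      simp only [Finset.card_univ, ZMod.card] at hσ ⊢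
      omega
    have := Finset.eq_of_subset_of_card_le (Finset.filter_subset _ _) hle
    have ha : a ∈ Finset.univ.filter (fun x : ZMod 2 => σ + Pi.single i x ∈ Y) := by
      rw [this]; simp
    simpa using ha
  have e0 := h.2 _ (hall 0) c
  have e1 := h.2 _ (hall 1) c
  rw [colVal_add_single] at e0 e1
  simp only [liftBit_zero, liftBit_one, zero_mul, one_mul, add_zero] at e0 e1
  have hs := sgn_sq (K := K) (σ i)
  generalize (1 - 2 * liftBit K (σ i)) = s at *
  have : s * f c i = 0 ∨ s * f c i = 1 ∨ s * f c i = -1 := by grind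
  have hs' : s = 1 ∨ s = -1 := mul_self_eq_one_iff.1 hs
  grind

lemma Good.pair (h2 : (2 : K) ≠ 0) {f : C → κ → K} {Y : Finset (κ → ZMod 2)}
    (h : Good f Y) {i k : κ} (hik : i ≠ k) (c d : C) (hc : f c i = f c k) (hc0 : f c i ≠ 0)
    (hd : f d i = - f d k) (hd0 : f d i ≠ 0) : False := by
  obtain ⟨σ, -, hσ⟩ := exists_dense Y (by simpa using h.1)
    (fun x : ZMod 2 × ZMod 2 => Pi.single i x.1 + Pi.single k x.2)
  have hσ := hσ inferInstance
  have key : ∀ x : ZMod 2 × ZMod 2, σ + (Pi.single i x.1 + Pi.single k x.2) ∈ Y → ∀ c,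
      (colVal (f c) σ + liftBit K x.1 * ((1 - 2 * liftBit K (σ i)) * f c i)
        + liftBit K x.2 * ((1 - 2 * liftBit K (σ k)) * f c k)) = 0 ∨
      (colVal (f c) σ + liftBit K x.1 * ((1 - 2 * liftBit K (σ i)) * f c i)
        + liftBit K x.2 * ((1 - 2 * liftBit K (σ k)) * f c k)) = 1 := by
    intro x hx c
    have := h.2 _ hx c
    rw [← add_assoc, colVal_add_single, colVal_add_single] at this
    simpa [Pi.single_eq_of_ne hik.symm] using this
  have hi : (1 - 2 * liftBit K (σ i)) = 1 ∨ (1 - 2 * liftBit K (σ i)) = -1 :=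
    mul_self_eq_one_iff.1 (sgn_sq _)
  have hk : (1 - 2 * liftBit K (σ k)) = 1 ∨ (1 - 2 * liftBit K (σ k)) = -1 :=
    mul_self_eq_one_iff.1 (sgn_sq _)
  generalize (1 - 2 * liftBit K (σ i)) = s at *
  generalize (1 - 2 * liftBit K (σ k)) = t at *
  have fc := h.single c i
  have fd := h.single d i
  have : ∃ c' d' : C, s * f c' i = t * f c' k ∧ (s * f c' i = 1 ∨ s * f c' i = -1) ∧
      s * f d' i = - (t * f d' k) ∧ (s * f d' i = 1 ∨ s * f d' i = -1) := by
    by_cases hst : s = t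
    · refine ⟨c, d, ?_, ?_, ?_, ?_⟩ <;> grind
    · refine ⟨d, c, ?_, ?_, ?_, ?_⟩ <;> grind
  obtain ⟨c', d', e1, e2, e3, e4⟩ := this
  have hbig : 2 < (Finset.univ.filter (fun x : ZMod 2 × ZMod 2 =>
      σ + (Pi.single i x.1 + Pi.single k x.2) ∈ Y)).card := by
    simp only [Fintype.card_prod, ZMod.card] at hσ
    omega
  rcases diag_forbid h2 (colVal (f c') σ) _ _ e2 e1 with ⟨a, ha⟩ | ha
  · rcases antidiag_forbid h2 (colVal (f d') σ) _ _ e4 e3 with ⟨b, hb⟩ | hb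
    · refine absurd (lt_of_lt_of_le hbig (Finset.card_le_card ?_)) (two_corners a b).not_gt
      intro x hx
      simp only [Finset.mem_filter, Finset.mem_univ, true_and] at hx ⊢
      have hx := key x hx
      refine ⟨?_, ?_⟩
      · rintro ⟨h1, h3⟩
        have := hx c'
        rw [h1, h3] at this
        exact ha this
      · rintro ⟨h1, h3⟩
        have := hx d'
        rw [h1, h3] at this
        exact hb this
    · refine absurd (lt_of_lt_of_le hbig (Finset.card_le_card ?_)) no_diag.not_gt
      intro x hx
      simp only [Finset.mem_filter, Finset.mem_univ, true_and] at hx ⊢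
      rintro a ⟨h1, h3⟩
      have := key x hx d'
      rw [h1, h3] at this
      exact hb a this
  · refine absurd (lt_of_lt_of_le hbig (Finset.card_le_card ?_)) no_antidiag.not_gt
    intro x hx
    simp only [Finset.mem_filter, Finset.mem_univ, true_and] at hx ⊢
    rintro a ⟨h1, h3⟩
    have := key x hx c'
    rw [h1, h3] at this
    exact ha a this

lemma Good.triple (h2 : (2 : K) ≠ 0) {f : C → κ → K} {Y : Finset (κ → ZMod 2)}
    (h : Good f Y) {i k l : κ} (hik : i ≠ k) (hil : i ≠ l) (hkl : k ≠ l) (c d e : C)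
    (c1 : f c i ≠ 0) (c2 : f c k ≠ 0) (c3 : f c l = 0)
    (d1 : f d i ≠ 0) (d2 : f d k = 0) (d3 : f d l ≠ 0)
    (e1 : f e i = 0) (e2 : f e k ≠ 0) (e3 : f e l ≠ 0) : False := by
  obtain ⟨σ, -, hσ⟩ := exists_dense Y (by simpa using h.1)
    (fun x : ZMod 2 × ZMod 2 × ZMod 2 =>
      Pi.single i x.1 + Pi.single k x.2.1 + Pi.single l x.2.2)
  have hσ := hσ inferInstance
  have key : ∀ x : ZMod 2 × ZMod 2 × ZMod 2,
      σ + (Pi.single i x.1 + Pi.single k x.2.1 + Pi.single l x.2.2) ∈ Y → ∀ c,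
      (colVal (f c) σ + liftBit K x.1 * ((1 - 2 * liftBit K (σ i)) * f c i)
        + liftBit K x.2.1 * ((1 - 2 * liftBit K (σ k)) * f c k)
        + liftBit K x.2.2 * ((1 - 2 * liftBit K (σ l)) * f c l)) = 0 ∨
      (colVal (f c) σ + liftBit K x.1 * ((1 - 2 * liftBit K (σ i)) * f c i)
        + liftBit K x.2.1 * ((1 - 2 * liftBit K (σ k)) * f c k)
        + liftBit K x.2.2 * ((1 - 2 * liftBit K (σ l)) * f c l)) = 1 := by
    intro x hx c
    have := h.2 _ hx c
    rw [← add_assoc, ← add_assoc, colVal_add_single, colVal_add_single,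
      colVal_add_single] at this
    simpa [Pi.single_eq_of_ne hik.symm, Pi.single_eq_of_ne hil.symm,
      Pi.single_eq_of_ne hkl.symm] using this
  have hi : (1 - 2 * liftBit K (σ i)) ≠ 0 := left_ne_zero_of_mul_eq_one (sgn_sq _)
  have hk : (1 - 2 * liftBit K (σ k)) ≠ 0 := left_ne_zero_of_mul_eq_one (sgn_sq _)
  have hl : (1 - 2 * liftBit K (σ l)) ≠ 0 := left_ne_zero_of_mul_eq_one (sgn_sq _)
  obtain ⟨a1, a2, ha⟩ := sq_forbid h2 (colVal (f c) σ) _ _ (mul_ne_zero hi c1) (mul_ne_zero hk c2)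
  obtain ⟨b1, b3, hb⟩ := sq_forbid h2 (colVal (f d) σ) _ _ (mul_ne_zero hi d1) (mul_ne_zero hl d3)
  obtain ⟨g2, g3, hg⟩ := sq_forbid h2 (colVal (f e) σ) _ _ (mul_ne_zero hk e2) (mul_ne_zero hl e3)
  have hle := three_edges a1 a2 b1 b3 g2 g3
  have hsub : Finset.univ.filter (fun x : ZMod 2 × ZMod 2 × ZMod 2 =>
      σ + (Pi.single i x.1 + Pi.single k x.2.1 + Pi.single l x.2.2) ∈ Y) ⊆
      Finset.univ.filter (fun x : ZMod 2 × ZMod 2 × ZMod 2 =>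
      ¬ (x.1 = a1 ∧ x.2.1 = a2) ∧ ¬ (x.1 = b1 ∧ x.2.2 = b3) ∧
      ¬ (x.2.1 = g2 ∧ x.2.2 = g3)) := by
    intro x hx
    simp only [Finset.mem_filter, Finset.mem_univ, true_and] at hx ⊢
    have hx := key x hx
    refine ⟨?_, ?_, ?_⟩
    · rintro ⟨h1, h3⟩
      have := hx c
      rw [h1, h3, c3, mul_zero, mul_zero, add_zero] at this
      exact ha this
    · rintro ⟨h1, h3⟩
      have := hx d
      rw [h1, h3, d2, mul_zero, mul_zero, add_zero] at this
      exact hb this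
    · rintro ⟨h1, h3⟩
      have := hx e
      rw [h1, h3, e1, mul_zero, mul_zero, add_zero] at this
      exact hg this
  have := Finset.card_le_card hsub
  simp only [Fintype.card_prod, ZMod.card] at hσ
  omega

end helpers

section space

variable {K : Type*} [Field K] {n : ℕ}

lemma schurMul_mem {C D : Submodule K (Fin n → K)} {x y : Fin n → K} (hx : x ∈ C) (hy : y ∈ D) :
    x * y ∈ schurMul C D := Submodule.subset_span ⟨x, hx, y, hy, rfl⟩

/-- Coordinates: a dual pair of rows and columns. -/
lemma exists_coords (V : Submodule K (Fin n → K)) :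
    ∃ (κ : Type) (_ : Fintype κ) (_ : DecidableEq κ) (f : κ → Fin n → K) (a : κ → Fin n),
      (∀ k, f k ∈ V) ∧ (∀ v ∈ V, v = ∑ k, v (a k) • f k) ∧
      Fintype.card κ = Module.finrank K V := by
  classical
  obtain ⟨κ, a, ha, hs, hl⟩ := exists_linearIndependent' K
    (fun i : Fin n => (LinearMap.proj i : (Fin n → K) →ₗ[K] K).comp V.subtype)
  have : Finite κ := Finite.of_injective a ha
  have := Fintype.ofFinite κ
  let e : V →ₗ[K] (κ → K) := LinearMap.pi (fun k => (LinearMap.proj (a k)).comp V.subtype)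
  have hinj : Function.Injective e := by
    rw [← LinearMap.ker_eq_bot, LinearMap.ker_eq_bot']
    intro v hv
    have h1 : ∀ φ ∈ Submodule.span K (Set.range
        ((fun i : Fin n => (LinearMap.proj i : (Fin n → K) →ₗ[K] K).comp V.subtype) ∘ a)),
        φ v = 0 := by
      intro φ hφ
      induction hφ using Submodule.span_induction with
      | mem x hx =>
        obtain ⟨k, rfl⟩ := hx
        exact congrFun hv k
      | zero => rfl
      | add x y _ _ hx hy => simp [hx, hy]
      | smul c x _ hx => simp [hx]
    ext i
    exact h1 ((LinearMap.proj i : (Fin n → K) →ₗ[K] K).comp V.subtype)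
      (hs ▸ Submodule.subset_span ⟨i, rfl⟩)
  have hcard : Fintype.card κ = Module.finrank K V := by
    apply le_antisymm
    · have := hl.fintype_card_le_finrank
      rwa [show Module.finrank K (V →ₗ[K] K) = Module.finrank K V from
        Subspace.dual_finrank_eq] at this
    · have := LinearMap.finrank_le_finrank_of_injective hinj
      simpa using this
  let E := LinearEquiv.ofInjectiveOfFinrankEq e hinj (by simp [hcard])
  have hE : ∀ v, E v = e v := fun v => rfl
  refine ⟨κ, inferInstance, inferInstance, fun k => (E.symm (Pi.single k 1) : V), a,
    fun k => (E.symm _).2, ?_, hcard⟩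
  intro v hv
  have : (⟨v, hv⟩ : V) = ∑ k, v (a k) • E.symm (Pi.single k 1) := by
    apply E.injective
    rw [map_sum]
    simp only [map_smul, LinearEquiv.apply_symm_apply]
    rw [hE]
    ext k
    simp [e, Finset.sum_apply, Pi.single_apply]
  have h3 := congrArg Subtype.val this
  simpa using h3

end space

section algebra

variable {K : Type*} [Field K] {n : ℕ} {κ : Type*} [Fintype κ] [DecidableEq κ]

/-- If the 0/1 vectors are dense then the Schur square is an algebra. -/
lemma square_closed (h2 : (2 : K) ≠ 0) (V : Submodule K (Fin n → K)) (f : κ → Fin n → K)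
    (hf : ∀ k, f k ∈ V) (hspan : V ≤ Submodule.span K (Set.range f))
    (Y : Finset (κ → ZMod 2)) (h : Good (fun c k => f k c) Y) :
    ∀ x ∈ schurMul V V, ∀ y ∈ schurMul V V, x * y ∈ schurMul V V := by
  have hcases := h.single
  -- products of rows are indicator-like
  have hpair : ∀ i k, ∃ ε : K, ε * ε = 1 ∧
      f i * f k = ε • ((f i * f i) * (f k * f k)) := by
    intro i k
    by_cases hik : i = k
    · subst hik
      refine ⟨1, by ring, ?_⟩
      ext c
      have := hcases c i
      simp only [Pi.mul_apply, Pi.smul_apply, smul_eq_mul]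
      grind
    by_cases hc : ∃ c, f i c = f k c ∧ f i c ≠ 0
    · obtain ⟨c, hc, hc0⟩ := hc
      refine ⟨1, by ring, ?_⟩
      ext d
      have h1 := hcases d i
      have h3 := hcases d k
      have h4 : f i d = - f k d → ¬ f i d ≠ 0 := fun hd hd0 =>
        h.pair h2 hik c d hc hc0 hd hd0
      simp only [Pi.mul_apply, Pi.smul_apply, smul_eq_mul]
      grind
    · refine ⟨-1, by ring, ?_⟩
      push Not at hc
      ext d
      have h1 := hcases d i
      have h3 := hcases d k
      have h4 := hc d
      simp only [Pi.mul_apply, Pi.smul_apply, smul_eq_mul]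
      grind
  set M := schurMul V V with hM
  have hgg : ∀ i k, (f i * f i) * (f k * f k) ∈ M := by
    intro i k
    obtain ⟨ε, he, hk⟩ := hpair i k
    have : (f i * f i) * (f k * f k) = ε • (f i * f k) := by
      rw [hk, smul_smul, he, one_smul]
    rw [this]
    exact M.smul_mem _ (schurMul_mem (hf i) (hf k))
  have hidem : ∀ i, (f i * f i) * (f i * f i) = f i * f i := by
    intro i
    ext c
    have := hcases c i
    simp only [Pi.mul_apply]
    grind
  have hggg : ∀ i k l, (f i * f i) * (f k * f k) * (f l * f l) ∈ M := by
    intro i k l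
    by_cases hik : i = k
    · subst hik; rw [hidem]; exact hgg _ _
    by_cases hkl : k = l
    · subst hkl; rw [mul_assoc, hidem]; exact hgg _ _
    by_cases hil : i = l
    · subst hil; rw [mul_right_comm, hidem]; exact hgg _ _
    by_cases p1 : ∃ c, f i c ≠ 0 ∧ f k c ≠ 0 ∧ f l c = 0
    · by_cases p2 : ∃ c, f i c ≠ 0 ∧ f k c = 0 ∧ f l c ≠ 0
      · by_cases p3 : ∃ c, f i c = 0 ∧ f k c ≠ 0 ∧ f l c ≠ 0
        · obtain ⟨c, c1, c2, c3⟩ := p1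
          obtain ⟨d, d1, d2, d3⟩ := p2
          obtain ⟨e, e1, e2, e3⟩ := p3
          exact (h.triple h2 hik hil hkl c d e c1 c2 c3 d1 d2 d3 e1 e2 e3).elim
        · push Not at p3
          convert hgg k l using 1
          ext c
          have h1 := hcases c i
          have h3 := p3 c
          simp only [Pi.mul_apply]
          rcases h1 with h1 | h1 | h1 <;> rw [h1] at h3 ⊢ <;> clear * - h3 <;>
            by_cases q1 : f k c = 0 <;> by_cases q2 : f l c = 0 <;> simp_all
      · push Not at p2
        convert hgg i l using 1
        ext c
        have h1 := hcases c k
        have h3 := p2 c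
        simp only [Pi.mul_apply]
        rcases h1 with h1 | h1 | h1 <;> rw [h1] at h3 ⊢ <;> clear * - h3 <;>
          by_cases q1 : f i c = 0 <;> by_cases q2 : f l c = 0 <;> simp_all
    · push Not at p1
      convert hgg i k using 1
      ext c
      have h1 := hcases c l
      have h3 := p1 c
      simp only [Pi.mul_apply]
      rcases h1 with h1 | h1 | h1 <;> rw [h1] at h3 ⊢ <;> clear * - h3 <;>
        by_cases q1 : f i c = 0 <;> by_cases q2 : f k c = 0 <;> simp_all
  -- generators of `M`
  have hgen : M ≤ Submodule.span K (Set.range (fun q : κ × κ => f q.1 * f q.2)) := by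
    rw [hM]
    unfold schurMul
    rw [Submodule.span_le]
    rintro _ ⟨u, hu, v, hv, rfl⟩
    have hu := hspan hu
    have hv := hspan hv
    show u * v ∈ Submodule.span K (Set.range (fun q : κ × κ => f q.1 * f q.2))
    have hmul := Submodule.mul_mem_mul hu hv
    rw [Submodule.span_mul_span] at hmul
    refine Submodule.span_mono ?_ hmul
    rintro _ ⟨_, ⟨i, rfl⟩, _, ⟨k, rfl⟩, rfl⟩
    exact ⟨(i, k), rfl⟩
  have hMg : ∀ m, ∀ x ∈ M, x * (f m * f m) ∈ M := by
    intro m x hx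
    replace hx := hgen hx
    induction hx using Submodule.span_induction with
    | mem x hx =>
      obtain ⟨⟨i, k⟩, rfl⟩ := hx
      obtain ⟨ε, he, hk⟩ := hpair i k
      simp only
      rw [hk, smul_mul_assoc]
      exact M.smul_mem _ (hggg i k m)
    | zero => simp
    | add x y _ _ hx hy => rw [add_mul]; exact M.add_mem hx hy
    | smul c x _ hx => rw [smul_mul_assoc]; exact M.smul_mem _ hx
  intro x hx y hy
  replace hy := hgen hy
  induction hy using Submodule.span_induction with
  | mem y hy =>
    obtain ⟨⟨i, k⟩, rfl⟩ := hy
    obtain ⟨ε, he, hk⟩ := hpair i k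
    simp only
    rw [hk, mul_smul_comm, ← mul_assoc]
    exact M.smul_mem _ (hMg _ _ (hMg _ _ hx))
  | zero => simp
  | add y z _ _ hy hz => rw [mul_add]; exact M.add_mem hy hz
  | smul c y _ hy => rw [mul_smul_comm]; exact M.smul_mem _ hy

end algebra

/-- for `p ≥ 3` prime, if `𝓕` contains two distinct nonempty sets
and `V^⟨3⟩` has trivial stabiliser, then `|V ∩ {0,1}ⁿ| ≤ 2^(dim V − 1)`.
(Recall `schurPow V 2 = V^⟨3⟩`.) -/
theorem statement11 (p n : ℕ) [Fact p.Prime] (hp3 : 3 ≤ p)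
    (𝓕 : Finset (Finset (Fin n)))
    (htwo : ∃ A ∈ 𝓕, ∃ B ∈ 𝓕, A ≠ B ∧ A ≠ ∅ ∧ B ≠ ∅)
    (V : Submodule (ZMod p) (Fin n → ZMod p))
    (hV : V = Submodule.span (ZMod p) (charVec (ZMod p) '' (𝓕 : Set (Finset (Fin n)))))
    (hst : Module.finrank (ZMod p) ↥(stab (schurPow V 2)) = 1) :
    Set.ncard {v | v ∈ V ∧ ∀ i, v i = 0 ∨ v i = 1} ≤
      2 ^ (Module.finrank (ZMod p) ↥V - 1) := by
  classical
  have hp2 : (2 : ZMod p) ≠ 0 := by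
    intro h
    have : ((2 : ℕ) : ZMod p) = 0 := by exact_mod_cast h
    rw [ZMod.natCast_eq_zero_iff] at this
    have := Nat.le_of_dvd (by norm_num) this
    omega
  obtain ⟨A, hA, B, hB, hAB, hA0, hB0⟩ := htwo
  have hAV : charVec (ZMod p) A ∈ V := hV ▸ Submodule.subset_span ⟨A, hA, rfl⟩
  have hBV : charVec (ZMod p) B ∈ V := hV ▸ Submodule.subset_span ⟨B, hB, rfl⟩
  have hne : ∀ S : Finset (Fin n), S ≠ ∅ → charVec (ZMod p) S ≠ 0 := by
    intro S hS h0
    obtain ⟨j, hj⟩ := Finset.nonempty_iff_ne_empty.2 hS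
    have := congrFun h0 j
    simp [charVec, hj] at this
  have hdpos : 0 < Module.finrank (ZMod p) V := by
    have : Nontrivial V := ⟨⟨⟨_, hAV⟩, 0, fun h => hne A hA0 (congrArg Subtype.val h)⟩⟩
    exact Module.finrank_pos
  by_contra hcon
  push Not at hcon
  obtain ⟨κ, _, _, f, a, hf, hexp, hcard⟩ := exists_coords V
  set X : Set (Fin n → ZMod p) := {v | v ∈ V ∧ ∀ i, v i = 0 ∨ v i = 1} with hX
  let Y : Finset (κ → ZMod 2) := Finset.univ.filter
    (fun σ => ∀ c, colVal (fun k => f k c) σ = 0 ∨ colVal (fun k => f k c) σ = 1)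
  have hXY : X.ncard ≤ Y.card := by
    rw [← Set.ncard_coe_finset Y]
    let φ : (Fin n → ZMod p) → (κ → ZMod 2) := fun v k => if v (a k) = 0 then 0 else 1
    have hφ : ∀ v ∈ X, ∀ k, liftBit (ZMod p) (φ v k) = v (a k) := by
      intro v hv k
      rcases hv.2 (a k) with h | h
      · simp [φ, h, liftBit_zero]
      · simp [φ, h, liftBit_one]
    have hφ2 : ∀ v ∈ X, ∀ c, colVal (fun k => f k c) (φ v) = v c := by
      intro v hv c
      conv_rhs => rw [hexp v hv.1]
      simp only [colVal, hφ v hv, Finset.sum_apply, Pi.smul_apply, smul_eq_mul]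
    refine Set.ncard_le_ncard_of_injOn φ ?_ ?_ (Finset.finite_toSet Y)
    · intro v hv
      simp only [Y, Finset.coe_filter, Finset.mem_univ, true_and, Set.mem_ofPred_eq]
      intro c
      rw [hφ2 v hv]
      exact hv.2 c
    · intro v hv w hw hvw
      ext c
      rw [← hφ2 v hv, ← hφ2 w hw, hvw]
  have hgood : Good (fun c k => f k c) Y := by
    refine ⟨?_, ?_⟩
    · rw [hcard]
      obtain ⟨m, hm⟩ := Nat.exists_eq_succ_of_ne_zero hdpos.ne'
      rw [hm] at hcon ⊢
      simp only [Nat.succ_eq_add_one, Nat.add_sub_cancel, pow_succ] at hcon ⊢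
      omega
    · intro σ hσ c
      exact (Finset.mem_filter.1 hσ).2 c
  have hspan : V ≤ Submodule.span (ZMod p) (Set.range f) := by
    intro v hv
    rw [hexp v hv]
    exact Submodule.sum_mem _ fun k _ => Submodule.smul_mem _ _ (Submodule.subset_span ⟨k, rfl⟩)
  have hclosed := square_closed hp2 V f hf hspan Y hgood
  have hVM : V ≤ schurMul V V := by
    conv_lhs => rw [hV]
    rw [Submodule.span_le]
    rintro _ ⟨S, hS, rfl⟩
    have hSV : charVec (ZMod p) S ∈ V := hV ▸ Submodule.subset_span ⟨S, hS, rfl⟩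
    have : charVec (ZMod p) S = charVec (ZMod p) S * charVec (ZMod p) S := by
      ext c
      simp [charVec]
    rw [this]
    exact schurMul_mem hSV hSV
  have h3 : schurPow V 2 = schurMul V V := by
    show schurMul (schurMul V V) V = schurMul V V
    apply le_antisymm
    · conv_lhs => unfold schurMul
      rw [Submodule.span_le]
      rintro _ ⟨u, hu, v, hv, rfl⟩
      exact hclosed u hu v (hVM hv)
    · conv_lhs => unfold schurMul
      rw [Submodule.span_le]
      rintro _ ⟨u, hu, v, hv, rfl⟩
      exact schurMul_mem (hVM hu) hv
  have hVst : V ≤ stab (schurPow V 2) := by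
    intro v hv e he
    rw [h3] at he ⊢
    exact hclosed v (hVM hv) e he
  obtain ⟨w, hw0, hw⟩ := finrank_eq_one_iff'.1 hst
  obtain ⟨r, hr⟩ := hw ⟨_, hVst hAV⟩
  obtain ⟨s, hs⟩ := hw ⟨_, hVst hBV⟩
  have hr := congrArg Subtype.val hr
  have hs := congrArg Subtype.val hs
  simp only [Submodule.coe_smul] at hr hs
  have hr0 : r ≠ 0 := by
    rintro rfl
    exact hne A hA0 (by rw [← hr]; simp)
  have hrel : ∀ j, r * charVec (ZMod p) B j = s * charVec (ZMod p) A j := by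
    intro j
    rw [← hr, ← hs]
    simp only [Pi.smul_apply, smul_eq_mul]
    ring
  obtain ⟨j, hj⟩ := Finset.nonempty_iff_ne_empty.2 hB0
  have hrs : r = s := by
    have := hrel j
    by_cases hjA : j ∈ A
    · simpa [charVec, hj, hjA] using this
    · simp [charVec, hj, hjA] at this
      exact absurd this hr0
  apply hAB
  ext j
  have := hrel j
  rw [← hrs] at this
  have := mul_left_cancel₀ hr0 this
  by_cases h1 : j ∈ A <;> by_cases h4 : j ∈ B <;> simp [charVec, h1, h4] at this ⊢
end
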